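/- arXiv:2202.13398 — 15 statements merged into one kernel-verified Lean document; each statement's English description precedes it below -/
import Mathlib

section
/- Let Σ be a type (the alphabet) and let L be a rotation-closed language over Σ. Then L is regular if and only if L is accepted by a deterministic finite circular automaton; that is, if and only if there exist a finite type Q, an initial state q₀ : Q, an accepting set T ⊆ Q, and transition maps δℓ, δr : Σ → Q → Q satisfying (i) δℓ a (δr b q) = δr b (δℓ a q) for all a b : Σ and q : Q, (ii) δℓ a q₀ = δr a q₀ for all a : Σ, (iii) (δℓ a q ∈ T ↔ δr a q ∈ T) for all a : Σ and q : Q, such that for every word w : List Σ, w ∈ L ↔ List.foldl (fun q a => δℓ a q) q₀ w ∈ T. -/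
/-- A rotation-closed language is regular iff it is accepted by a deterministic
finite circular automaton. -/
theorem stmt_0 {α : Type} (L : Language α)
    (hrot : ∀ u v : List α, u ++ v ∈ L ↔ v ++ u ∈ L) :
    L.IsRegular ↔
      ∃ (Q : Type) (_ : Fintype Q) (q₀ : Q) (T : Set Q) (δℓ δr : α → Q → Q),
        (∀ (a b : α) (q : Q), δℓ a (δr b q) = δr b (δℓ a q)) ∧
        (∀ a : α, δℓ a q₀ = δr a q₀) ∧
        (∀ (a : α) (q : Q), δℓ a q ∈ T ↔ δr a q ∈ T) ∧
        (∀ w : List α, w ∈ L ↔ List.foldl (fun q a => δℓ a q) q₀ w ∈ T) := by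
  constructor
  · rintro ⟨σ, _, M, rfl⟩
    let Q := {f : σ → σ // ∃ w : List α, (fun s => M.evalFrom s w) = f}
    let append (a : α) (q : Q) : Q := ⟨fun s => M.step (q.1 s) a, by
      obtain ⟨_, w, rfl⟩ := q
      exact ⟨w ++ [a], by simp⟩⟩
    let prepend (a : α) (q : Q) : Q := ⟨fun s => q.1 (M.step s a), by
      obtain ⟨_, w, rfl⟩ := q
      exact ⟨a :: w, by simp⟩⟩
    let one : Q := ⟨id, [], rfl⟩
    have foldl_append (w : List α) (q : Q) :
        (w.foldl (fun q a => append a q) q).1 = fun s => M.evalFrom (q.1 s) w := by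
      induction w generalizing q with
      | nil => rfl
      | cons a w ih => rw [List.foldl_cons, ih]; rfl
    refine ⟨Q, Fintype.ofFinite Q, one, {q | q.1 M.start ∈ M.accept}, append, prepend,
      fun _ _ _ => rfl, fun _ => rfl, ?_, ?_⟩
    · rintro a ⟨_, w, rfl⟩
      have h := hrot w [a]
      simp only [DFA.mem_accepts, DFA.eval, DFA.evalFrom_of_append] at h
      exact h
    · intro w
      rw [Set.mem_ofPred_eq, foldl_append]
      rfl
  · rintro ⟨Q, hQ, q₀, T, δℓ, δr, -, -, -, h⟩
    exact ⟨Q, hQ, ⟨fun q a => δℓ a q, q₀, T⟩, Set.ext fun w => (h w).symm⟩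
end

section
/- Let (Q, q₀, δℓ, δr, T) be a deterministic circular automaton over an alphabet Σ. Define the two-sided run of a pair of words (u, v) by run u v := List.foldl (fun q a => δℓ a q) (List.foldr (fun a q => δr a q) q₀ v) u. Then acceptance of a circular word does not depend on where the two reading marks meet: for all words u, v : List Σ, run (u ++ v) [] ∈ T ↔ run u v ∈ T. (In particular, run (u ++ [a]) v ∈ T ↔ run u (a :: v) ∈ T for every letter a.) -/
/-- The two-sided run of a deterministic circular automaton: the left mark reads `u`
from the left using `δℓ`, the right mark reads `v` from the right using `δr`. -/
def circRun {α Q : Type*} (q₀ : Q) (δℓ δr : α → Q → Q) (u v : List α) : Q :=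
  List.foldl (fun q a => δℓ a q) (List.foldr (fun a q => δr a q) q₀ v) u

/-- Reading a letter with the right mark commutes with reading a word with the left mark. -/
theorem circRun_cons_right {α Q : Type*} (q₀ : Q) (δℓ δr : α → Q → Q)
    (hcomm : ∀ (a b : α) (q : Q), δℓ a (δr b q) = δr b (δℓ a q))
    (u v : List α) (a : α) :
    circRun q₀ δℓ δr u (a :: v) = δr a (circRun q₀ δℓ δr u v) :=
  List.foldl_hom (δr a) fun q b => hcomm b a q

/-- Moving the meeting point of the two marks across one letter preserves acceptance. -/
theorem circRun_append_singleton_mem_iff {α Q : Type*} (q₀ : Q) (T : Set Q)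
    (δℓ δr : α → Q → Q)
    (hcomm : ∀ (a b : α) (q : Q), δℓ a (δr b q) = δr b (δℓ a q))
    (hacc : ∀ (a : α) (q : Q), δℓ a q ∈ T ↔ δr a q ∈ T) (u v : List α) (a : α) :
    circRun q₀ δℓ δr (u ++ [a]) v ∈ T ↔ circRun q₀ δℓ δr u (a :: v) ∈ T := by
  rw [circRun_cons_right q₀ δℓ δr hcomm, ← hacc]
  simp [circRun]

/-- Acceptance of a circular word by a deterministic circular automaton does not
depend on where the two reading marks meet. -/
theorem stmt_1 {α Q : Type*} (q₀ : Q) (T : Set Q) (δℓ δr : α → Q → Q)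
    (hcomm : ∀ (a b : α) (q : Q), δℓ a (δr b q) = δr b (δℓ a q))
    (hinit : ∀ a : α, δℓ a q₀ = δr a q₀)
    (hacc : ∀ (a : α) (q : Q), δℓ a q ∈ T ↔ δr a q ∈ T) :
    ∀ u v : List α,
      (circRun q₀ δℓ δr (u ++ v) [] ∈ T ↔ circRun q₀ δℓ δr u v ∈ T) ∧
      ∀ a : α,
        (circRun q₀ δℓ δr (u ++ [a]) v ∈ T ↔ circRun q₀ δℓ δr u (a :: v) ∈ T) := by
  intro u v
  have step := circRun_append_singleton_mem_iff q₀ T δℓ δr hcomm hacc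
  refine ⟨?_, step u v⟩
  induction v generalizing u with
  | nil => simp
  | cons a v ih => rw [← step, ← ih, List.append_assoc, List.singleton_append]
end

section
/- Let (Q, q₀, δℓ, δr, T) be a deterministic circular automaton over an alphabet Σ. Then the language accepted by its left-transition part, L := {w : List Σ | List.foldl (fun q a => δℓ a q) q₀ w ∈ T}, is rotation-closed: for all words u, v, u ++ v ∈ L ↔ v ++ u ∈ L. -/
/-- A map commuting with every step of a left fold commutes with the whole fold. -/
theorem foldl_apply_of_commute {α Q : Type*} (f : α → Q → Q) (g : Q → Q)
    (h : ∀ (a : α) (q : Q), f a (g q) = g (f a q)) (w : List α) (q : Q) :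
    List.foldl (fun q a => f a q) (g q) w = g (List.foldl (fun q a => f a q) q w) := by
  induction w generalizing q with
  | nil => rfl
  | cons a w ih => rw [List.foldl_cons, h, ih, List.foldl_cons]


/-- The language accepted by the left-transition part of a deterministic circular
automaton is rotation-closed. -/
theorem stmt_2 {α Q : Type*} (q₀ : Q) (T : Set Q) (δℓ δr : α → Q → Q)
    (hcomm : ∀ (a b : α) (q : Q), δℓ a (δr b q) = δr b (δℓ a q))
    (hinit : ∀ a : α, δℓ a q₀ = δr a q₀)
    (hacc : ∀ (a : α) (q : Q), δℓ a q ∈ T ↔ δr a q ∈ T) :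
    ∀ u v : List α,
      u ++ v ∈ {w : List α | List.foldl (fun q a => δℓ a q) q₀ w ∈ T} ↔
      v ++ u ∈ {w : List α | List.foldl (fun q a => δℓ a q) q₀ w ∈ T} := by
  have rotate_one (a : α) (w : List α) :
      List.foldl (fun q a => δℓ a q) q₀ (a :: w) ∈ T ↔
        List.foldl (fun q a => δℓ a q) q₀ (w ++ [a]) ∈ T := by
    rw [List.foldl_cons, hinit,
      foldl_apply_of_commute δℓ (δr a) (fun b q => hcomm b a q), ← hacc, List.foldl_append]
    rfl
  intro u v
  simp only [Set.mem_ofPred_eq]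
  induction u generalizing v with
  | nil => simp
  | cons a u ih =>
    rw [List.cons_append, rotate_one, List.append_assoc, ih, List.append_assoc,
      List.singleton_append]
end

section
/- Let M be a finite B-semimodule, i.e. a finite join-semilattice with least element. For a : M define f_a : M → Bool by f_a b = true ↔ ¬(b ≤ a). Then each f_a preserves ⊔ and ⊥ (is a SupBotHom M Bool), and the assignment a ↦ f_a is a bijection from M onto SupBotHom M Bool which is order-reversing: a ≤ a' implies f_{a'} ≤ f_a pointwise. In particular M and its dual M* = SupBotHom M Bool have the same cardinality, and the Bool-valued homomorphisms separate points: for a ≠ b in M there exists f : SupBotHom M Bool with f a ≠ f b. -/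
open Classical in
/-- The homomorphism `M → Bool` whose kernel is the principal ideal below `a`. -/
noncomputable def SupBotHom.notLE {M : Type*} [SemilatticeSup M] [OrderBot M] (a : M) :
    SupBotHom M Bool where
  toFun b := decide (¬ b ≤ a)
  map_sup' b c := by
    by_cases hb : b ≤ a <;> by_cases hc : c ≤ a <;> simp [hb, hc]
  map_bot' := by simp

open Classical in
theorem SupBotHom.notLE_eq_true_iff {M : Type*} [SemilatticeSup M] [OrderBot M] (a b : M) :
    SupBotHom.notLE a b = true ↔ ¬ b ≤ a :=
  decide_eq_true_iff

theorem SupBotHom.notLE_injective {M : Type*} [SemilatticeSup M] [OrderBot M] :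
    Function.Injective (SupBotHom.notLE : M → SupBotHom M Bool) := by
  intro a a' h
  have key (b : M) : b ≤ a ↔ b ≤ a' := by
    rw [← not_iff_not, ← notLE_eq_true_iff, ← notLE_eq_true_iff, h]
  exact le_antisymm ((key a).1 le_rfl) ((key a').2 le_rfl)

open Classical in
theorem SupBotHom.notLE_surjective {M : Type*} [SemilatticeSup M] [OrderBot M] [Finite M] :
    Function.Surjective (SupBotHom.notLE : M → SupBotHom M Bool) := by
  intro f
  have := Fintype.ofFinite M
  let s : Finset M := Finset.univ.filter fun b => f b = false
  have hs : f (s.sup id) = ⊥ := by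
    rw [map_finset_sup, Finset.sup_eq_bot_iff]
    intro b hb
    exact (Finset.mem_filter.1 hb).2
  refine ⟨s.sup id, SupBotHom.ext fun b => ?_⟩
  rw [Bool.eq_iff_iff, notLE_eq_true_iff, ← Bool.not_eq_false, not_iff_not]
  constructor
  · intro hb
    exact le_bot_iff.1 (hs ▸ OrderHomClass.mono f hb)
  · intro hb
    exact Finset.le_sup (f := id) (Finset.mem_filter.2 ⟨Finset.mem_univ b, hb⟩)

/-- For a finite B-semimodule `M`, the maps `f_a b = true ↔ ¬ b ≤ a` are
`SupBotHom`s `M → Bool`, and `a ↦ f_a` is an order-reversing bijection of `M` onto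
the dual `M* = SupBotHom M Bool`; in particular `M` and `M*` have the same
cardinality and the Bool-valued homomorphisms separate points. -/
theorem stmt_5 {M : Type*} [SemilatticeSup M] [OrderBot M] [Finite M] :
    ∃ F : M → SupBotHom M Bool,
      (∀ a b : M, F a b = true ↔ ¬ b ≤ a) ∧
      Function.Bijective F ∧
      (∀ a a' : M, a ≤ a' → ∀ b : M, F a' b ≤ F a b) ∧
      Nat.card M = Nat.card (SupBotHom M Bool) ∧
      (∀ a b : M, a ≠ b → ∃ f : SupBotHom M Bool, f a ≠ f b) := by
  have hbij : Function.Bijective (SupBotHom.notLE : M → SupBotHom M Bool) :=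
    ⟨SupBotHom.notLE_injective, SupBotHom.notLE_surjective⟩
  refine ⟨SupBotHom.notLE, SupBotHom.notLE_eq_true_iff, hbij, ?_,
    Nat.card_eq_of_bijective _ hbij, ?_⟩
  · intro a a' h b
    rw [Bool.le_iff_imp, SupBotHom.notLE_eq_true_iff, SupBotHom.notLE_eq_true_iff]
    exact fun hb hba => hb (hba.trans h)
  · intro a b hab
    by_contra! h
    have key (c : M) : a ≤ c ↔ b ≤ c := by
      rw [← not_iff_not, ← SupBotHom.notLE_eq_true_iff, ← SupBotHom.notLE_eq_true_iff, h]
    exact hab (le_antisymm ((key b).2 le_rfl) ((key a).1 le_rfl))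
end

section
/- Let M be a finite B-semimodule, i.e. a finite join-semilattice with least element. Then the canonical evaluation map M → SupBotHom (SupBotHom M Bool) Bool sending a to the homomorphism f ↦ f a is well-defined (it preserves ⊔ and ⊥) and is a bijection; that is, the natural map from M to its double dual M** is an isomorphism of B-semimodules. -/
namespace SupBotHom

variable {M : Type*} [SemilatticeSup M] [OrderBot M]

open Classical in
/-- The homomorphism to `Bool` whose kernel is the principal ideal of elements below `a`. -/
noncomputable def notLE_s6 (a : M) : SupBotHom M Bool where
  toFun x := !decide (x ≤ a)
  map_sup' x y := by simp [sup_le_iff]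
  map_bot' := by simp

theorem notLE_eq_false_iff {a x : M} : notLE_s6 a x = false ↔ x ≤ a := by
  simp [notLE_s6, ← SupBotHom.toFun_eq_coe]

theorem exists_eq_notLE [Finite M] (f : SupBotHom M Bool) : ∃ a, f = notLE_s6 a := by
  classical
  have := Fintype.ofFinite M
  let s : Finset M := {x | f x = false}
  have hs : f (s.sup id) = false := by
    rw [map_finset_sup]
    exact (Finset.sup_eq_bot_iff _ _).2 fun x hx => (Finset.mem_filter.1 hx).2
  refine ⟨s.sup id, ext fun x => ?_⟩
  rw [Bool.eq_iff_iff, ← not_iff_not, Bool.not_eq_true, Bool.not_eq_true, notLE_eq_false_iff]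
  refine ⟨fun hx => Finset.le_sup (f := id) (by simp [s, hx]), fun hx => ?_⟩
  exact le_bot_iff.1 ((OrderHomClass.mono f hx).trans hs.le)

theorem notLE_le_notLE_iff {a b : M} : notLE_s6 a ≤ notLE_s6 b ↔ b ≤ a := by
  refine ⟨fun h => ?_, fun h x => ?_⟩
  · rw [← notLE_eq_false_iff]
    exact le_bot_iff.1 ((h b).trans (notLE_eq_false_iff.2 le_rfl).le)
  · by_cases hx : x ≤ b
    · exact (notLE_eq_false_iff.2 (hx.trans h)).trans_le bot_le
    · rw [← notLE_eq_false_iff, Bool.not_eq_false] at hx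
      exact le_top.trans hx.ge

/-- The evaluation homomorphism from `M` to its double dual. -/
def dualEval (M : Type*) [SemilatticeSup M] [OrderBot M] :
    SupBotHom M (SupBotHom (SupBotHom M Bool) Bool) where
  toFun a :=
    { toFun f := f a
      map_sup' _ _ := rfl
      map_bot' := rfl }
  map_sup' a b := ext fun f => map_sup f a b
  map_bot' := ext fun f => map_bot f

theorem dualEval_apply (a : M) (f : SupBotHom M Bool) : dualEval M a f = f a := rfl

theorem dualEval_injective : Function.Injective (dualEval M) := by
  intro a b h
  have key (c : M) : a ≤ c ↔ b ≤ c := by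
    rw [← notLE_eq_false_iff, ← notLE_eq_false_iff, ← dualEval_apply, h, dualEval_apply]
  exact le_antisymm ((key b).2 le_rfl) ((key a).1 le_rfl)

theorem dualEval_surjective [Finite M] : Function.Surjective (dualEval M) := by
  intro F
  have : Finite (SupBotHom M Bool) := DFunLike.finite _
  obtain ⟨g, rfl⟩ := exists_eq_notLE F
  obtain ⟨m, rfl⟩ := exists_eq_notLE g
  refine ⟨m, ext fun f => ?_⟩
  obtain ⟨a, rfl⟩ := exists_eq_notLE f
  rw [dualEval_apply, Bool.eq_iff_iff, ← not_iff_not, Bool.not_eq_true, Bool.not_eq_true,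
    notLE_eq_false_iff, notLE_eq_false_iff, notLE_le_notLE_iff]

end SupBotHom

/-- For a finite B-semimodule `M`, the canonical evaluation map from `M` to its
double dual `SupBotHom (SupBotHom M Bool) Bool` is a well-defined `SupBotHom` and
a bijection. -/
theorem stmt_6 {M : Type*} [SemilatticeSup M] [OrderBot M] [Finite M] :
    ∃ ev : SupBotHom M (SupBotHom (SupBotHom M Bool) Bool),
      (∀ (a : M) (f : SupBotHom M Bool), ev a f = f a) ∧
      Function.Bijective ev :=
  ⟨SupBotHom.dualEval M, SupBotHom.dualEval_apply, SupBotHom.dualEval_injective,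
    SupBotHom.dualEval_surjective⟩
end

section
/- Let P be a finite lattice with least element ⊥ (equivalently, a finite B-semimodule with its canonical lattice structure). Then P is distributive — i.e. x ⊓ (y ⊔ z) ≤ (x ⊓ y) ⊔ (x ⊓ z) holds for all x, y, z : P — if and only if P is a retract of a finite free B-semimodule: there exist n and SupBotHoms ι : P → (Fin n → Bool) and p : (Fin n → Bool) → P with p ∘ ι = id. -/
/-- A retract, in the category of join-semilattices, of a distributive lattice is distributive. -/
theorem inf_sup_le_of_retract {P D : Type*} [Lattice P] [DistribLattice D]
    (ι : SupHom P D) (p : SupHom D P) (h : ∀ x, p (ι x) = x) (x y z : P) :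
    x ⊓ (y ⊔ z) ≤ (x ⊓ y) ⊔ (x ⊓ z) := by
  have hι : Monotone ι := OrderHomClass.mono ι
  have hp : Monotone p := OrderHomClass.mono p
  have key (a b : P) : p (ι a ⊓ ι b) ≤ a ⊓ b :=
    le_inf ((hp inf_le_left).trans_eq (h a)) ((hp inf_le_right).trans_eq (h b))
  calc x ⊓ (y ⊔ z) = p (ι (x ⊓ (y ⊔ z))) := (h _).symm
    _ ≤ p (ι x ⊓ ι (y ⊔ z)) := hp (le_inf (hι inf_le_left) (hι inf_le_right))
    _ = p (ι x ⊓ ι y) ⊔ p (ι x ⊓ ι z) := by rw [map_sup, inf_sup_left, map_sup]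
    _ ≤ (x ⊓ y) ⊔ (x ⊓ z) := sup_le_sup (key x y) (key x z)

open Classical in
/-- The homomorphism recording which members of a family of join-primes lie below an element. -/
noncomputable def SupBotHom.ofSupPrime {P J : Type*} [Lattice P] [OrderBot P] (e : J → P)
    (he : ∀ j, SupPrime (e j)) : SupBotHom P (J → Bool) where
  toFun x j := decide (e j ≤ x)
  map_sup' x y := by ext j; simp [(he j).le_sup]
  map_bot' := by ext j; simp [(he j).ne_bot]

/-- The homomorphism from the free semimodule on a finite type that extends a given family. -/
def SupBotHom.freeLift {P J : Type*} [Lattice P] [OrderBot P] [Fintype J] (e : J → P) :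
    SupBotHom (J → Bool) P where
  toFun f := Finset.univ.sup fun j => if f j then e j else ⊥
  map_sup' f g := by
    rw [← Finset.sup_sup]
    congr 1
    ext j
    cases hf : f j <;> cases hg : g j <;> simp [hf, hg]
  map_bot' := by simp

theorem SupBotHom.freeLift_apply {P J : Type*} [Lattice P] [OrderBot P] [Fintype J] (e : J → P)
    (f : J → Bool) : freeLift e f = Finset.univ.sup fun j => if f j then e j else ⊥ :=
  rfl

open Classical in
theorem SupBotHom.ofSupPrime_apply {P J : Type*} [Lattice P] [OrderBot P] (e : J → P)
    (he : ∀ j, SupPrime (e j)) (x : P) (j : J) : ofSupPrime e he x j = decide (e j ≤ x) :=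
  rfl

/-- A finite distributive lattice is a retract of a finite free semimodule. -/
theorem exists_retract_of_distribLattice (P : Type*) [DistribLattice P] [OrderBot P] [Finite P] :
    ∃ (n : ℕ) (ι : SupBotHom P (Fin n → Bool)) (p : SupBotHom (Fin n → Bool) P),
      ∀ x : P, p (ι x) = x := by
  obtain ⟨n, ⟨e⟩⟩ := Finite.exists_equiv_fin {a : P // SupIrred a}
  refine ⟨n, .ofSupPrime (fun i => (e.symm i).1) fun i => (e.symm i).2.supPrime,
    .freeLift fun i => (e.symm i).1, fun x => ?_⟩
  simp only [SupBotHom.freeLift_apply, SupBotHom.ofSupPrime_apply]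
  refine le_antisymm (Finset.sup_le fun i _ => ?_) ?_
  · by_cases h : (e.symm i).1 ≤ x <;> simp [h]
  · obtain ⟨s, hs, hirr⟩ := exists_supIrred_decomposition x
    conv_lhs => rw [← hs]
    refine Finset.sup_le fun a ha => ?_
    have hax : a ≤ x := hs ▸ Finset.le_sup (f := id) ha
    refine le_trans ?_ (Finset.le_sup (Finset.mem_univ (e ⟨a, hirr ha⟩)))
    simp [hax]

/-- A finite lattice with least element is distributive iff it is a retract of a
finite free B-semimodule `Fin n → Bool`. -/
theorem stmt_9 {P : Type} [Lattice P] [OrderBot P] [Fintype P] :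
    (∀ x y z : P, x ⊓ (y ⊔ z) ≤ (x ⊓ y) ⊔ (x ⊓ z)) ↔
    (∃ (n : ℕ) (ι : SupBotHom P (Fin n → Bool)) (p : SupBotHom (Fin n → Bool) P),
        ∀ x : P, p (ι x) = x) := by
  constructor
  · intro h
    let : DistribLattice P := .ofInfSupLe h
    exact exists_retract_of_distribLattice P
  · rintro ⟨n, ι, p, h⟩
    exact inf_sup_le_of_retract ι.toSupHom p.toSupHom h
end

section
/- Let P be a finite B-semimodule. Then P is a retract of a finite free B-semimodule (there exist n and SupBotHoms ι : P → (Fin n → Bool) and p : (Fin n → Bool) → P with p ∘ ι = id) if and only if P admits a coevaluation element (decomposition of the identity): there exist k, elements a : Fin k → P and homomorphisms f : Fin k → SupBotHom P Bool such that every m : P satisfies m = (Finset.univ.filter (fun i => f i m = true)).sup a, i.e. the identity of P decomposes as a finite supremum of rank-one maps m ↦ (f i m) • (a i). -/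
/-- The homomorphism out of the free B-semimodule on `κ` that sends the `i`-th generator to `a i`. -/
def supBotHomOfGenerators {κ P : Type*} [Fintype κ] [SemilatticeSup P] [OrderBot P] (a : κ → P) :
    SupBotHom (κ → Bool) P where
  toFun v := (Finset.univ.filter (fun i => v i = true)).sup a
  map_sup' v w := by
    classical
    rw [← Finset.sup_union, ← Finset.filter_or]
    simp
  map_bot' := by simp

/-- The homomorphism into the free B-semimodule on `κ` with coordinates `f`. -/
def supBotHomPi {κ P : Type*} [SemilatticeSup P] [OrderBot P] (f : κ → SupBotHom P Bool) :
    SupBotHom P (κ → Bool) where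
  toFun m i := f i m
  map_sup' x y := by ext i; simp
  map_bot' := by ext i; simp

/-- The `i`-th coordinate of a homomorphism into a free B-semimodule. -/
def supBotHomCoord {κ P : Type*} [SemilatticeSup P] [OrderBot P] (g : SupBotHom P (κ → Bool))
    (i : κ) : SupBotHom P Bool where
  toFun m := g m i
  map_sup' x y := by simp
  map_bot' := by simp

lemma sup_filter_single_eq {κ : Type*} [Fintype κ] [DecidableEq κ] (v : κ → Bool) :
    (Finset.univ.filter (fun i => v i = true)).sup
      (fun i => (Function.update ⊥ i true : κ → Bool)) = v := by
  apply le_antisymm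
  · refine Finset.sup_le fun i hi => ?_
    rw [update_le_iff]
    exact ⟨(Finset.mem_filter.1 hi).2.ge, fun _ _ => bot_le⟩
  · intro j
    cases hj : v j with
    | false => exact Bool.false_le _
    | true =>
      have h := Finset.le_sup (s := Finset.univ.filter (fun i => v i = true))
        (f := fun i => (Function.update ⊥ i true : κ → Bool)) (Finset.mem_filter.2 ⟨Finset.mem_univ j, hj⟩) j
      simpa using h

/-- A finite B-semimodule is a retract of a finite free B-semimodule iff it admits
a coevaluation element (decomposition of the identity): the identity decomposes as
a finite supremum of rank-one maps `m ↦ (f i m) • (a i)`. -/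
theorem stmt_10 {P : Type} [SemilatticeSup P] [OrderBot P] [Finite P] :
    (∃ (n : ℕ) (ι : SupBotHom P (Fin n → Bool)) (p : SupBotHom (Fin n → Bool) P),
        ∀ x : P, p (ι x) = x) ↔
    (∃ (k : ℕ) (a : Fin k → P) (f : Fin k → SupBotHom P Bool),
        ∀ m : P, m = (Finset.univ.filter (fun i => f i m = true)).sup a) := by
  constructor
  · rintro ⟨n, ι, p, h⟩
    refine ⟨n, fun i => p (Function.update ⊥ i true), supBotHomCoord ι, fun m => ?_⟩
    calc m = p (ι m) := (h m).symm
      _ = p ((Finset.univ.filter (fun i => ι m i = true)).sup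
            (fun i => Function.update ⊥ i true)) := by rw [sup_filter_single_eq]
      _ = _ := map_finset_sup p _ _
  · rintro ⟨k, a, f, h⟩
    exact ⟨k, supBotHomPi f, supBotHomOfGenerators a, fun x => (h x).symm⟩
end

section
/- Every nonempty finite distributive lattice is isomorphic to the lattice of open sets of a finite topological space: if M is a type with [DistribLattice M] [Fintype M] [Nonempty M], then there exist a type X with [Fintype X] and a topology on X together with an order isomorphism M ≃o TopologicalSpace.Opens X (under which joins in M correspond to unions of open sets). -/
/-- The lower sets of a preorder are the open sets of its lower set topology. -/
def LowerSet.orderIsoOpens (α : Type*) [Preorder α] :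
    LowerSet α ≃o @TopologicalSpace.Opens α (Topology.lowerSet α) :=
  letI := Topology.lowerSet α
  { toFun := fun s ↦ ⟨s, s.lower⟩
    invFun := fun U ↦ ⟨U, U.isOpen⟩
    left_inv := fun _ ↦ rfl
    right_inv := fun _ ↦ rfl
    map_rel_iff' := Iff.rfl }

/-- Every nonempty finite distributive lattice is order-isomorphic to the lattice
of open sets of a finite topological space. -/
theorem stmt_11 {M : Type} [DistribLattice M] [Fintype M] [Nonempty M] :
    ∃ (X : Type) (_ : Fintype X) (_ : TopologicalSpace X),
      Nonempty (M ≃o TopologicalSpace.Opens X) := by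
  classical
  let := Fintype.toOrderBot M
  exact ⟨{a : M // SupIrred a}, inferInstance, Topology.lowerSet _,
    ⟨OrderIso.lowerSetSupIrred.trans (LowerSet.orderIsoOpens _)⟩⟩
end

section
/- Let Σ be a type and L a language over Σ. If L admits a decomposition of the identity — that is, there exist n and words u, v : Fin n → List Σ such that for all words x, y : List Σ, x ++ y ∈ L ↔ ∃ i, (x ++ u i ∈ L ∧ v i ++ y ∈ L) — then L is a regular language. (Indeed, the set of left residuals {fun y => decide (x ++ y ∈ L) | x : List Σ} then has at most 2^n elements.) -/
/-- A language admitting a decomposition of the identity is regular. -/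
theorem stmt_12 {α : Type} (L : Language α) (n : ℕ) (u v : Fin n → List α)
    (h : ∀ x y : List α, x ++ y ∈ L ↔ ∃ i : Fin n, x ++ u i ∈ L ∧ v i ++ y ∈ L) :
    L.IsRegular := by
  refine Language.IsRegular.of_finite_range_leftQuotient ?_
  -- The left quotient by `x` is determined by the set of `i` with `x ++ u i ∈ L`.
  let residual : Set (Fin n) → Language α := fun s => {y | ∃ i ∈ s, v i ++ y ∈ L}
  refine (Set.finite_range residual).subset ?_
  rintro _ ⟨x, rfl⟩
  exact ⟨{i | x ++ u i ∈ L}, Set.ext fun y => (h x y).symm⟩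
end

section
/- Let L be a language over Σ and let (u, v : Fin n → List Σ) be a decomposition of the identity for L. Then the induced circular language L∘ := {w : List Σ | ∃ i, v i ++ w ++ u i ∈ L} is rotation-closed: for all words w₁, w₂, w₁ ++ w₂ ∈ L∘ ↔ w₂ ++ w₁ ∈ L∘. (Equivalently, inserting the decomposition of the identity once more anywhere on the circle does not change the evaluation: for all w₁, w₂, (∃ i j, v i ++ w₁ ++ u j ∈ L ∧ v j ++ w₂ ++ u i ∈ L) ↔ w₁ ++ w₂ ∈ L∘.) -/
/-- Inserting a decomposition of the identity once more on the circle does not change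
membership in the induced circular language. -/
theorem exists_append_mem_iff_exists_split {α ι : Type*} {L : Language α} {u v : ι → List α}
    (h : ∀ x y : List α, x ++ y ∈ L ↔ ∃ i, x ++ u i ∈ L ∧ v i ++ y ∈ L) (w₁ w₂ : List α) :
    (∃ i, v i ++ (w₁ ++ w₂) ++ u i ∈ L) ↔
      ∃ i j, v i ++ w₁ ++ u j ∈ L ∧ v j ++ w₂ ++ u i ∈ L := by
  refine exists_congr fun i => ?_
  simpa only [List.append_assoc] using h (v i ++ w₁) (w₂ ++ u i)

/-- The circular language induced by a decomposition of the identity for `L` is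
rotation-closed. -/
theorem stmt_13 {α : Type} (L : Language α) (n : ℕ) (u v : Fin n → List α)
    (h : ∀ x y : List α, x ++ y ∈ L ↔ ∃ i : Fin n, x ++ u i ∈ L ∧ v i ++ y ∈ L) :
    ∀ w₁ w₂ : List α,
      w₁ ++ w₂ ∈ {w : List α | ∃ i : Fin n, v i ++ w ++ u i ∈ L} ↔
      w₂ ++ w₁ ∈ {w : List α | ∃ i : Fin n, v i ++ w ++ u i ∈ L} := by
  intro w₁ w₂
  rw [Set.mem_ofPred_eq, Set.mem_ofPred_eq, exists_append_mem_iff_exists_split h,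
    exists_append_mem_iff_exists_split h, exists_comm]
  simp only [and_comm]
end

section
/- Let L be a language over Σ and let (u, v : Fin n → List Σ) and (u', v' : Fin m → List Σ) be two decompositions of the identity for L. Then the induced circular language does not depend on the chosen decomposition: for every word w : List Σ, (∃ i, v i ++ w ++ u i ∈ L) ↔ (∃ j, v' j ++ w ++ u' j ∈ L). -/
/-- One inclusion between the circular languages induced by two decompositions of the identity. -/
theorem exists_circular_mem_of_decomposition {α ι κ : Type*} {L : Language α}
    {u v : ι → List α} {u' v' : κ → List α}
    (h : ∀ x y : List α, x ++ y ∈ L ↔ ∃ i, x ++ u i ∈ L ∧ v i ++ y ∈ L)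
    (h' : ∀ x y : List α, x ++ y ∈ L ↔ ∃ j, x ++ u' j ∈ L ∧ v' j ++ y ∈ L)
    {w : List α} (hw : ∃ i, v i ++ w ++ u i ∈ L) : ∃ j, v' j ++ w ++ u' j ∈ L := by
  obtain ⟨i, hi⟩ := hw
  obtain ⟨j, hj, hji⟩ := (h' _ _).1 hi
  refine ⟨j, ?_⟩
  rw [List.append_assoc] at hj ⊢
  exact (h _ _).2 ⟨i, hji, hj⟩

/-- The circular language induced by a decomposition of the identity for `L` does
not depend on the chosen decomposition. -/
theorem stmt_14 {α : Type} (L : Language α) (n m : ℕ)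
    (u v : Fin n → List α) (u' v' : Fin m → List α)
    (h : ∀ x y : List α, x ++ y ∈ L ↔ ∃ i : Fin n, x ++ u i ∈ L ∧ v i ++ y ∈ L)
    (h' : ∀ x y : List α, x ++ y ∈ L ↔ ∃ j : Fin m, x ++ u' j ∈ L ∧ v' j ++ y ∈ L) :
    ∀ w : List α,
      (∃ i : Fin n, v i ++ w ++ u i ∈ L) ↔ (∃ j : Fin m, v' j ++ w ++ u' j ∈ L) := by
  exact fun w => ⟨exists_circular_mem_of_decomposition h h',
    exists_circular_mem_of_decomposition h' h⟩
end

section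
/- Let Σ be a type and L a language over Σ with decidable membership. The following are equivalent: (a) L is regular; (b) the set of residual functions Set.range ρ ⊆ (List Σ → Bool) is finite; (c) the state space A(−) attached to L, namely the sup-closure of {ρ x | x : List Σ} ∪ {⊥} in List Σ → Bool, is a finite set. -/
/-- The residual function of a word `x` with respect to a language `L`. -/
def rho {α : Type} (L : Language α) [DecidablePred (· ∈ L)] (x : List α) :
    List α → Bool :=
  fun y => decide (x ++ y ∈ L)

/-- The Boolean residuals of a language are finitely many iff its left quotients are. -/
theorem finite_range_rho_iff {α : Type} (L : Language α) [DecidablePred (· ∈ L)] :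
    (Set.range (rho L)).Finite ↔ (Set.range L.leftQuotient).Finite := by
  let support : (List α → Bool) → Language α := fun f => {y | f y = true}
  have support_injective : Function.Injective support := fun f g h => by
    funext y
    exact Bool.eq_iff_iff.mpr (Set.ext_iff.mp h y)
  have support_rho : L.leftQuotient = support ∘ rho L := by
    funext x
    ext y
    exact (decide_eq_true_iff (p := x ++ y ∈ L)).symm
  rw [support_rho, Set.range_comp, Set.finite_image_iff support_injective.injOn]

/-- For a language `L` with decidable membership, the following are equivalent:
`L` is regular; the set of residual functions is finite; the state space `A(−)`
attached to `L` (the sup-closure of the residuals together with `⊥`) is finite. -/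
theorem stmt_16 {α : Type} (L : Language α) [DecidablePred (· ∈ L)] :
    (L.IsRegular ↔ (Set.range (rho L)).Finite) ∧
    (L.IsRegular ↔
      (supClosure (Set.range (rho L) ∪ {(⊥ : List α → Bool)})).Finite) := by
  have regular_iff : L.IsRegular ↔ (Set.range (rho L)).Finite :=
    Language.isRegular_iff_finite_range_leftQuotient.trans (finite_range_rho_iff L).symm
  refine ⟨regular_iff, regular_iff.trans ⟨fun h => ?_, fun h => ?_⟩⟩
  · exact (h.union (Set.finite_singleton _)).supClosure
  · exact h.subset (Set.subset_union_left.trans subset_supClosure)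
end

section
/- Let Σ be a type and L a language over Σ with decidable membership. Form the Nerode automaton N(L): its state type is the subtype Q := {f : List Σ → Bool // ∃ x, f = ρ x}, its transition sends a state f and a letter a to mₐ f (which again lies in Q, since mₐ (ρ x) = ρ (x ++ [a])), its start state is ρ [], and a state f is accepting iff f [] = true. Then: (a) N(L) accepts exactly L: for every word w, w is accepted by N(L) ↔ w ∈ L; (b) N(L) is minimal: for every deterministic finite automaton M : DFA Σ σ with Fintype σ and M.accepts = L, one has Nat.card (Set.range ρ) ≤ Fintype.card σ. -/
theorem rho_cons {α : Type} (L : Language α) [DecidablePred (· ∈ L)] (x : List α) (a : α) :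
    (fun y => rho L x (a :: y)) = rho L (x ++ [a]) := by
  funext y
  simp [rho]

/-- The Nerode automaton of `L`, whose states are the residual functions of `L`. -/
def nerodeDFA {α : Type} (L : Language α) [DecidablePred (· ∈ L)] :
    DFA α {f : List α → Bool // ∃ x : List α, f = rho L x} where
  step q a := ⟨fun y => q.val (a :: y), by
    obtain ⟨_, x, rfl⟩ := q
    exact ⟨x ++ [a], rho_cons L x a⟩⟩
  start := ⟨rho L [], [], rfl⟩
  accept := {q | q.val [] = true}

theorem nerodeDFA_evalFrom_val {α : Type} (L : Language α) [DecidablePred (· ∈ L)]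
    (q : {f : List α → Bool // ∃ x : List α, f = rho L x}) (w y : List α) :
    ((nerodeDFA L).evalFrom q w).val y = q.val (w ++ y) := by
  induction w generalizing q with
  | nil => rfl
  | cons a w ih => exact ih ((nerodeDFA L).step q a)

theorem mem_nerodeDFA_accepts {α : Type} (L : Language α) [DecidablePred (· ∈ L)]
    (w : List α) : w ∈ (nerodeDFA L).accepts ↔ w ∈ L := by
  change ((nerodeDFA L).evalFrom (nerodeDFA L).start w).val [] = true ↔ w ∈ L
  rw [nerodeDFA_evalFrom_val]
  simp [nerodeDFA, rho]

theorem card_range_rho_le {α σ : Type} (L : Language α) [DecidablePred (· ∈ L)] [Fintype σ]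
    (M : DFA α σ) (hM : M.accepts = L) :
    Nat.card (Set.range (rho L)) ≤ Fintype.card σ := by
  classical
  let g : σ → List α → Bool := fun s y => decide (M.evalFrom s y ∈ M.accept)
  have hsub : Set.range (rho L) ⊆ Set.range g := by
    rintro _ ⟨x, rfl⟩
    refine ⟨M.eval x, funext fun y => ?_⟩
    simp only [g, rho, decide_eq_decide]
    rw [← hM, DFA.mem_accepts, DFA.eval, DFA.evalFrom_of_append]
  calc Nat.card (Set.range (rho L)) ≤ Nat.card (Set.range g) :=
        Nat.card_mono (Set.finite_range g) hsub
    _ ≤ Nat.card σ := Finite.card_range_le g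
    _ = Fintype.card σ := Nat.card_eq_fintype_card

/-- The Nerode automaton of a language `L`: its states are the residual functions
of `L`, its transition is the letter action `mₐ`, its start state is `ρ []`, and a
state `f` is accepting iff `f [] = true`. It accepts exactly `L`, and it is minimal
among deterministic finite automata accepting `L`. -/
theorem stmt_17 {α : Type} (L : Language α) [DecidablePred (· ∈ L)] :
    ∃ N : DFA α {f : List α → Bool // ∃ x : List α, f = rho L x},
      (∀ (q : {f : List α → Bool // ∃ x : List α, f = rho L x}) (a : α),
        (N.step q a).val = fun y => q.val (a :: y)) ∧
      N.start.val = rho L [] ∧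
      N.accept = {q : {f : List α → Bool // ∃ x : List α, f = rho L x} | q.val [] = true} ∧
      (∀ w : List α, w ∈ N.accepts ↔ w ∈ L) ∧
      (∀ (σ : Type) [Fintype σ] (M : DFA α σ), M.accepts = L →
        Nat.card (Set.range (rho L)) ≤ Fintype.card σ) := by
  exact ⟨nerodeDFA L, fun _ _ => rfl, rfl, rfl, mem_nerodeDFA_accepts L,
    fun _ _ M hM => card_range_rho_le L M hM⟩
end

section
/- Let Σ be a type, L a language over Σ with decidable membership, and M : DFA Σ σ a deterministic automaton with M.accepts = L in which every state is reachable from the start state: for every s : σ there is a word x with M.eval x = s. Define r : σ → (List Σ → Bool) by r s = fun y => decide (M.evalFrom s y ∈ M.accept). Then: (a) r (M.eval x) = ρ x for every word x, and r is a surjection of σ onto Set.range ρ; (b) r M.start = ρ []; (c) r (M.step s a) = mₐ (r s) for all s, a; (d) s ∈ M.accept ↔ (r s) [] = true; (e) r is the unique map σ → (List Σ → Bool) satisfying (b) and (c). Thus every trim deterministic automaton accepting L surjects onto the minimal (Nerode) automaton of L. -/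
/-- The letter action on Boolean functions on words: `(mA a f) y = f (a :: y)`. -/
def mA {α : Type} (a : α) (f : List α → Bool) : List α → Bool :=
  fun y => f (a :: y)

/-- The Boolean function attached to a state `s` of a DFA `M`:
`y ↦ decide (M.evalFrom s y ∈ M.accept)`. -/
def resid {α σ : Type} (M : DFA α σ) [DecidablePred (· ∈ M.accept)] (s : σ) :
    List α → Bool :=
  fun y => decide (M.evalFrom s y ∈ M.accept)

theorem mA_rho {α : Type} (L : Language α) [DecidablePred (· ∈ L)] (x : List α) (a : α) :
    mA a (rho L x) = rho L (x ++ [a]) := by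
  funext y
  simp [mA, rho]

theorem resid_step {α σ : Type} (M : DFA α σ) [DecidablePred (· ∈ M.accept)] (s : σ) (a : α) :
    resid M (M.step s a) = mA a (resid M s) :=
  rfl

theorem resid_start {α σ : Type} (L : Language α) [DecidablePred (· ∈ L)]
    (M : DFA α σ) [DecidablePred (· ∈ M.accept)] (hacc : M.accepts = L) :
    resid M M.start = rho L [] := by
  subst hacc
  funext y
  simp [resid, rho, DFA.mem_accepts, DFA.eval]

/-- A map that sends the start state to `rho L []` and intertwines the transitions with the
letter action sends the state reached by `x` to `rho L x`. -/
theorem apply_eval_eq_rho {α σ : Type} (L : Language α) [DecidablePred (· ∈ L)] (M : DFA α σ)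
    (r : σ → List α → Bool) (hstart : r M.start = rho L [])
    (hstep : ∀ (s : σ) (a : α), r (M.step s a) = mA a (r s)) (x : List α) :
    r (M.eval x) = rho L x := by
  induction x using List.reverseRecOn with
  | nil => exact hstart
  | append_singleton x a ih => rw [DFA.eval_append_singleton, hstep, ih, mA_rho]

/-- Every trim deterministic automaton accepting `L` surjects onto the minimal
(Nerode) automaton of `L`, via the map `r = resid M`, which is moreover the unique
map intertwining start states and transitions. -/
theorem stmt_18 {α σ : Type} (L : Language α) [DecidablePred (· ∈ L)]
    (M : DFA α σ) [DecidablePred (· ∈ M.accept)] (hacc : M.accepts = L)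
    (htrim : ∀ s : σ, ∃ x : List α, M.eval x = s) :
    (∀ x : List α, resid M (M.eval x) = rho L x) ∧
    Set.range (resid M) = Set.range (rho L) ∧
    resid M M.start = rho L [] ∧
    (∀ (s : σ) (a : α), resid M (M.step s a) = mA a (resid M s)) ∧
    (∀ s : σ, s ∈ M.accept ↔ resid M s [] = true) ∧
    (∀ r' : σ → (List α → Bool),
      r' M.start = rho L [] →
      (∀ (s : σ) (a : α), r' (M.step s a) = mA a (r' s)) →
      r' = resid M) := by
  have hstart := resid_start L M hacc
  have heval := apply_eval_eq_rho L M (resid M) hstart (resid_step M)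
  refine ⟨heval, ?_, hstart, resid_step M, fun s => decide_eq_true_iff.symm, fun r' h₀ h₁ => ?_⟩
  · have hsurj : Function.Surjective M.eval := htrim
    rw [← hsurj.range_comp (resid M)]
    exact congrArg Set.range (funext heval)
  · funext s
    obtain ⟨x, rfl⟩ := htrim s
    rw [apply_eval_eq_rho L M r' h₀ h₁, heval]
end

section
/- Let Σ be a type, L a language over Σ with decidable membership, Q a finite type, and φ : Q → (List Σ → Bool) a family of Boolean functions (a lifting of states to the state space of L). Let I : Set Q and Δ : Q → Σ → Set Q satisfy: (a) the lifted initial element covers the residual of the empty word: for every word y, y ∈ L ↔ ∃ q ∈ I, φ q y = true; and (b) the transitions lift the letter action: for every q : Q, a : Σ and word y, φ q (a :: y) = true ↔ ∃ q' ∈ Δ q a, φ q' y = true (i.e. mₐ (φ q) is the pointwise supremum of φ over Δ q a). Then the nondeterministic finite automaton with state type Q, transition Δ, start set I, and accepting set {q | φ q [] = true} accepts exactly L: for every word w, w is accepted by this NFA ↔ w ∈ L. -/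
/-- If Boolean functions `φ q` detect acceptance on the empty word and turn letters into
suprema over transitions, then `φ q` describes the words accepted from the state `q`. -/
theorem NFA.mem_acceptsFrom_iff_of_lift {α σ : Type*} (M : NFA α σ) (φ : σ → List α → Bool)
    (hnil : ∀ q, q ∈ M.accept ↔ φ q [] = true)
    (hcons : ∀ q a y, φ q (a :: y) = true ↔ ∃ q' ∈ M.step q a, φ q' y = true)
    (S : Set σ) (w : List α) : w ∈ M.acceptsFrom S ↔ ∃ q ∈ S, φ q w = true := by
  induction w generalizing S with
  | nil => simp only [NFA.nil_mem_acceptsFrom, hnil]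
  | cons a w ih =>
    simp only [NFA.cons_mem_acceptsFrom, ih, NFA.mem_stepSet, hcons]
    grind

/-- Any lifting of the state space data of a language `L` to a family of Boolean
functions indexed by a finite type `Q`, compatible with the initial element and
the letter action, yields a nondeterministic finite automaton accepting exactly
`L`. -/
theorem stmt_19 {α : Type} {Q : Type} [Finite Q] (L : Language α)
    (φ : Q → (List α → Bool)) (I : Set Q) (Δ : Q → α → Set Q)
    (hI : ∀ y : List α, y ∈ L ↔ ∃ q ∈ I, φ q y = true)
    (hΔ : ∀ (q : Q) (a : α) (y : List α),
      φ q (a :: y) = true ↔ ∃ q' ∈ Δ q a, φ q' y = true) :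
    ∀ w : List α, w ∈ (NFA.mk Δ I {q : Q | φ q [] = true}).accepts ↔ w ∈ L := by
  intro w
  rw [hI w]
  exact NFA.mem_acceptsFrom_iff_of_lift _ φ (fun _ => Iff.rfl) hΔ I w
end
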